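/- arXiv:1105.4159 — 2 statements merged into one kernel-verified Lean document; each statement's English description precedes it below -/
import Mathlib

section
/- There exists a constant c > 0, depending only on the spatial dimension D, the no-strings constant α ≥ 1 and the exponent β > 0, such that for every L ≥ 2 the following holds: if a local stabilizer code on Λ = (ℤ/Lℤ)^D satisfies the topological order conditions at some scale L_tqo ≥ L^β and obeys the no-strings rule with constant α, then every logical operator has energy barrier at least c·log L. -/
open Finset

namespace BH

/-- The lattice `Λ = (ℤ/Lℤ)^D`. -/
abbrev Site (L D : ℕ) := Fin D → ZMod L

/-- Pauli operators modulo phase on a set `Q` of qubits, written additively: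
`E = (Eˣ, Eᶻ)` componentwise over `𝔽₂ × 𝔽₂`. -/
abbrev Pauli (Q : Type) := Q → ZMod 2 × ZMod 2

/-- A single-qubit Pauli operator: one supported on a single qubit. -/
def singleQubit {Q : Type} (E : Pauli Q) : Prop :=
  ∃ q, ∀ q', E q' ≠ 0 → q' = q

/-- The weight of a Pauli operator: the cardinality of its support. -/
noncomputable def pweight {Q : Type} [Fintype Q] (E : Pauli Q) : ℕ :=
  (Finset.univ.filter fun q => E q ≠ 0).card

/-- The symplectic form `ω(E,F) = Σ_q (Eˣ_q Fᶻ_q + Eᶻ_q Fˣ_q)`;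
`E` and `F` commute iff `ω(E,F) = 0`. -/
def sympForm {Q : Type} [Fintype Q] (E F : Pauli Q) : ZMod 2 :=
  ∑ q, ((E q).1 * (F q).2 + (E q).2 * (F q).1)

/-- Partial product (= sum, in additive notation) `E_t ⋯ E_2 E_1` of the
first `t` errors of an error path. -/
def partialSum {Q : Type} {T : ℕ} (Ep : Fin T → Pauli Q) (t : ℕ) : Pauli Q :=
  ∑ s : Fin T, if (s : ℕ) < t then Ep s else 0

/-- Distance on the cyclic group `ℤ/Lℤ` (periodic boundary conditions). -/
def cDist {L : ℕ} (a b : ZMod L) : ℕ := min (a - b).val (b - a).val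

/-- The `l_∞` distance on the lattice `(ℤ/Lℤ)^D`. -/
def dist' {L D : ℕ} (u v : Site L D) : ℕ :=
  Finset.univ.sup fun i => cDist (u i) (v i)

/-- `l_∞` diameter of a finite set of sites. -/
def fdiam {L D : ℕ} (X : Finset (Site L D)) : ℕ :=
  X.sup fun u => X.sup fun v => dist' u v

/-- `l_∞` distance between two finite sets of sites. -/
noncomputable def fdist {L D : ℕ} (X Y : Finset (Site L D)) : ℕ :=
  sInf {d | ∃ u ∈ X, ∃ v ∈ Y, dist' u v = d}

/-- `B_r(A)`: the set of points at distance at most `r` from `A`. -/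
def ball {L D : ℕ} (r : ℝ) (A : Set (Site L D)) : Set (Site L D) :=
  {v | ∃ u ∈ A, ((dist' u v : ℕ) : ℝ) ≤ r}

/-- The cube of linear size `ℓ` with corner `c`. -/
def cubeSet {L D : ℕ} (c : Site L D) (ℓ : ℝ) : Set (Site L D) :=
  {v | ∀ i, (((v i - c i).val : ℕ) : ℝ) ≤ ℓ}

/-- The elementary cube with corner `c` (a translate of `{0,1}^D`). -/
def elemCube {L D : ℕ} [NeZero L] (c : Site L D) : Finset (Site L D) :=
  Finset.univ.filter fun v => ∀ i, (v i - c i).val ≤ 1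

/-- The level-`p` unit of length `ξ(p) = (10α)^p`. -/
def ξ (α : ℝ) (p : ℕ) : ℝ := (10 * α) ^ p

/-- A local stabilizer code on `Λ = (ℤ/Lℤ)^D` with `K` qubits per site:
a family of pairwise commuting Pauli operators `G a`, each supported on the
sites of the elementary cube located at `loc a`. -/
structure Code (L D K : ℕ) [NeZero L] (A : Type) [Fintype A] where
  G : A → Pauli (Site L D × Fin K)
  loc : A → Site L D
  comm : ∀ a b, sympForm (G a) (G b) = 0
  localGen : ∀ a q, G a q ≠ 0 → q.1 ∈ elemCube (loc a)

variable {L D K : ℕ} [NeZero L] {A : Type} [Fintype A]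

/-- `E` is supported (as a set of sites) inside `X`. -/
def suppIn (E : Pauli (Site L D × Fin K)) (X : Set (Site L D)) : Prop :=
  ∀ q, E q ≠ 0 → q.1 ∈ X

/-- `E` is supported in some cube of linear size `ℓ`. -/
def smallSupp (E : Pauli (Site L D × Fin K)) (ℓ : ℝ) : Prop :=
  ∃ c, suppIn E (cubeSet c ℓ)

/-- `(c, ℓ)` is a smallest cube enclosing `X`. -/
def minEnclosing {L D : ℕ} (c : Site L D) (ℓ : ℝ) (X : Set (Site L D)) : Prop :=
  0 ≤ ℓ ∧ X ⊆ cubeSet c ℓ ∧ ∀ c' ℓ', 0 ≤ ℓ' → X ⊆ cubeSet c' ℓ' → ℓ ≤ ℓ'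

namespace Code

/-- The stabilizer group `𝒢`. -/
def stab (code : Code L D K A) : AddSubgroup (Pauli (Site L D × Fin K)) :=
  AddSubgroup.closure (Set.range code.G)

/-- The syndrome of `E`: the set of generators anticommuting with `E` (defects). -/
def syndrome (code : Code L D K A) (E : Pauli (Site L D × Fin K)) : Finset A :=
  Finset.univ.filter fun a => sympForm (code.G a) E = 1

/-- The set of lattice sites covered by the elementary cubes of a set `S` of
defects (the syndrome regarded as a set of elementary cubes). -/
def synSites (code : Code L D K A) (S : Finset A) : Finset (Site L D) :=
  S.biUnion fun a => elemCube (code.loc a)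

/-- A set of defects is neutral if it is the syndrome of some Pauli operator
supported in a cube of linear size `Ltqo`; otherwise it is charged. -/
def neutral (code : Code L D K A) (Ltqo : ℝ) (S : Finset A) : Prop :=
  ∃ E, code.syndrome E = S ∧ smallSupp E Ltqo

/-- (TQO1) Every Pauli operator with empty syndrome supported in a cube of
linear size `Ltqo` is a stabilizer. -/
def tqo1 (code : Code L D K A) (Ltqo : ℝ) : Prop :=
  ∀ E, smallSupp E Ltqo → code.syndrome E = ∅ → E ∈ code.stab

/-- (TQO2) Every neutral set `S` of defects is the syndrome of some Pauli
operator supported on `B₁(C_min(S))`. -/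
def tqo2 (code : Code L D K A) (Ltqo : ℝ) : Prop :=
  ∀ S, code.neutral Ltqo S →
    ∀ c ℓ, minEnclosing c ℓ (code.synSites S : Set (Site L D)) →
      ∃ E, code.syndrome E = S ∧ suppIn E (ball 1 (cubeSet c ℓ))

/-- The topological order conditions at scale `Ltqo`. -/
def tqo (code : Code L D K A) (Ltqo : ℝ) : Prop :=
  code.tqo1 Ltqo ∧ code.tqo2 Ltqo

open scoped Classical in
/-- The part of the set `S` of defects whose elementary cubes lie inside `X`. -/
noncomputable def partIn (code : Code L D K A) (S : Finset A) (X : Set (Site L D)) :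
    Finset A :=
  S.filter fun a => ∀ v ∈ elemCube (code.loc a), v ∈ X

/-- The no-strings rule with constant `α`: for any Pauli operator supported in a
cube of linear size `Ltqo` whose syndrome is contained in two disjoint cubes of
linear size `ρ` at mutual distance at least `α·ρ`, the part of the syndrome in
each cube is neutral. -/
def noStrings (code : Code L D K A) (Ltqo α : ℝ) : Prop :=
  ∀ (E : Pauli (Site L D × Fin K)) (ρ : ℝ) (c₁ c₂ : Site L D), 0 < ρ →
    smallSupp E Ltqo →
    Disjoint (cubeSet c₁ ρ) (cubeSet c₂ ρ) →
    (∀ u ∈ cubeSet c₁ ρ, ∀ v ∈ cubeSet c₂ ρ, α * ρ ≤ ((dist' u v : ℕ) : ℝ)) →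
    (code.synSites (code.syndrome E) : Set (Site L D)) ⊆ cubeSet c₁ ρ ∪ cubeSet c₂ ρ →
    code.neutral Ltqo (code.partIn (code.syndrome E) (cubeSet c₁ ρ)) ∧
    code.neutral Ltqo (code.partIn (code.syndrome E) (cubeSet c₂ ρ))

/-- A logical operator: commutes with all generators but is not a stabilizer. -/
def logical (code : Code L D K A) (E : Pauli (Site L D × Fin K)) : Prop :=
  (∀ a, sympForm (code.G a) E = 0) ∧ E ∉ code.stab

/-- `P` has energy barrier at least `ω`: every error path implementing `P`
passes through a syndrome with at least `ω` defects. -/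
def barrierAtLeast (code : Code L D K A) (P : Pauli (Site L D × Fin K)) (ω : ℝ) : Prop :=
  ∀ (T : ℕ) (Ep : Fin T → Pauli (Site L D × Fin K)),
    (∀ t, singleQubit (Ep t)) → partialSum Ep T = P →
    ∃ t ≤ T, ω ≤ ((code.syndrome (partialSum Ep t)).card : ℝ)

end Code

end BH

namespace BH

set_option linter.unusedSectionVars false
set_option linter.unusedVariables false

section geom

variable {L D K : ℕ} [NeZero L] {A : Type} [Fintype A]

theorem cDist_eq (a b : ZMod L) : cDist a b = (a - b).valMinAbs.natAbs := by
  unfold cDist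
  rw [ZMod.valMinAbs_natAbs_eq_min, ← neg_sub a b, ZMod.neg_val]
  split_ifs with h
  · simp [h]
  · rfl

theorem cDist_self (a : ZMod L) : cDist a a = 0 := by simp [cDist]

theorem cDist_comm (a b : ZMod L) : cDist a b = cDist b a := by
  unfold cDist; rw [min_comm]

theorem cDist_triangle (a b c : ZMod L) : cDist a c ≤ cDist a b + cDist b c := by
  simp only [cDist_eq]
  have h : a - c = (a - b) + (b - c) := by abel
  rw [h]
  exact (ZMod.natAbs_valMinAbs_add_le _ _).trans (Int.natAbs_add_le _ _)

theorem dist'_le {u v : Site L D} {n : ℕ} : dist' u v ≤ n ↔ ∀ i, cDist (u i) (v i) ≤ n := by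
  unfold dist'; simp

theorem dist'_self (u : Site L D) : dist' u u = 0 :=
  Nat.le_zero.1 (dist'_le.2 fun i => (cDist_self _).le)

theorem dist'_comm (u v : Site L D) : dist' u v = dist' v u := by
  unfold dist'; simp only [cDist_comm]

theorem dist'_triangle (u v w : Site L D) : dist' u w ≤ dist' u v + dist' v w :=
  dist'_le.2 fun i => (cDist_triangle _ (v i) _).trans
    (add_le_add (dist'_le.1 le_rfl i) (dist'_le.1 le_rfl i))

theorem elemCube_dist {c v : Site L D} (h : v ∈ elemCube c) : dist' c v ≤ 1 := by
  simp only [elemCube, mem_filter, mem_univ, true_and] at h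
  exact dist'_le.2 fun i => (min_le_right _ _).trans (h i)

theorem self_mem_elemCube (c : Site L D) : c ∈ elemCube c := by
  simp [elemCube]

theorem cDist_of_val {c v w : ZMod L} {n : ℕ} (hv : (v - c).val ≤ n) (hw : (w - c).val ≤ n) :
    cDist v w ≤ n := by
  unfold cDist
  rcases le_total (v - c).val (w - c).val with h | h
  · have : w - v = (w - c) - (v - c) := by abel
    have h2 := ZMod.val_sub h
    rw [← this] at h2
    exact (min_le_right _ _).trans (by omega)
  · have : v - w = (v - c) - (w - c) := by abel
    have h2 := ZMod.val_sub h
    rw [← this] at h2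
    exact (min_le_left _ _).trans (by omega)

theorem cube_dist {c v w : Site L D} {l : ℝ} {n : ℕ} (hl : l ≤ n) (hv : v ∈ cubeSet c l)
    (hw : w ∈ cubeSet c l) : dist' v w ≤ n := by
  refine dist'_le.2 fun i => cDist_of_val (c := c i) ?_ ?_
  · exact_mod_cast (hv i).trans hl
  · exact_mod_cast (hw i).trans hl

/-- the corner of the cube around `u` of radius `r` -/
def corner (u : Site L D) (r : ℕ) : Site L D := fun i => u i - (r : ZMod L)

theorem val_shift {u v : ZMod L} {r : ℕ} (h : cDist u v ≤ r) :
    (v - (u - (r : ZMod L))).val ≤ 2 * r := by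
  unfold cDist at h
  rcases min_le_iff.1 h with h | h
  · have : v - (u - (r : ZMod L)) = ((r - (u - v).val : ℕ) : ZMod L) := by
      rw [Nat.cast_sub h, ZMod.natCast_zmod_val]; abel
    rw [this]
    rw [ZMod.val_natCast]; exact (Nat.mod_le _ _).trans (by omega)
  · have : v - (u - (r : ZMod L)) = ((r + (v - u).val : ℕ) : ZMod L) := by
      rw [Nat.cast_add, ZMod.natCast_zmod_val]; abel
    rw [this]
    rw [ZMod.val_natCast]; exact (Nat.mod_le _ _).trans (by omega)

theorem mem_cube {u v : Site L D} {r : ℕ} {l : ℝ} (h : dist' u v ≤ r) (hl : 2 * (r : ℝ) ≤ l) :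
    v ∈ cubeSet (corner u r) l := fun i => by
  refine le_trans ?_ hl
  exact_mod_cast val_shift (dist'_le.1 h i)

theorem elem_mem_cube {u v w : Site L D} {r : ℕ} (h : dist' u v ≤ r) (hw : w ∈ elemCube v) :
    w ∈ cubeSet (corner u r) (2 * r + 1 : ℕ) := fun i => by
  have h1 := val_shift (dist'_le.1 h i)
  simp only [elemCube, mem_filter, mem_univ, true_and] at hw
  have h2 := hw i
  have : w i - corner u r i = (w i - v i) + (v i - (u i - (r : ZMod L))) := by
    unfold corner; abel
  rw [this]
  have := ZMod.val_add_le (w i - v i) (v i - (u i - (r : ZMod L)))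
  exact_mod_cast this.trans (by omega)

theorem exists_minEnclosing (X : Set (Site L D)) :
    ∃ c, ∃ n : ℕ, minEnclosing c (n : ℝ) X ∧
      ∀ c' (m : ℕ), X ⊆ cubeSet c' (m : ℝ) → n ≤ m := by
  classical
  have hex : ∃ n : ℕ, ∃ c, X ⊆ cubeSet c (n : ℝ) :=
    ⟨L, 0, fun v _ i => by exact_mod_cast (ZMod.val_lt _).le⟩
  obtain ⟨c, hc⟩ := Nat.find_spec hex
  refine ⟨c, Nat.find hex, ⟨Nat.cast_nonneg _, hc, ?_⟩, fun c' m h => Nat.find_min' hex ⟨c', h⟩⟩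
  intro c' l hl h
  have : Nat.find hex ≤ ⌊l⌋₊ := Nat.find_min' hex ⟨c', fun v hv i => by
    exact_mod_cast Nat.le_floor (h hv i)⟩
  exact (Nat.cast_le.2 this).trans (Nat.floor_le hl)

end geom

section count

theorem count_levels {A : Type} [DecidableEq A] (d : A → A → ℕ)
    (hs : ∀ a, d a a = 0) (hc : ∀ a b, d a b = d b a)
    (ht : ∀ a b c, d a c ≤ d a b + d b c) (S : Finset A) (r : ℕ → ℕ) (M : ℕ)
    (hr : ∀ q, r (q + 1) = (M + 2) * r q) (p : ℕ)
    (hd : ∀ q < p, ∃ a ∈ S, ∃ b ∈ S, r q < d a b ∧ d a b ≤ M * r q) :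
    ∃ f : A → A, (S.image f).card + p ≤ S.card ∧
      ∀ a ∈ S, ∀ b ∈ S, f a = f b → d a b ≤ r p := by
  induction p with
  | zero =>
    refine ⟨id, by simp, fun a _ b _ h => ?_⟩
    have h : a = b := h
    subst h; simp [hs]
  | succ p ih =>
    obtain ⟨f, hf1, hf2⟩ := ih fun q hq => hd q (by omega)
    obtain ⟨a, ha, b, hb, h1, h2⟩ := hd p (by omega)
    have hab : f a ≠ f b := fun h => absurd (hf2 a ha b hb h) (by omega)
    have hrp : r (p + 1) = M * r p + r p + r p := by rw [hr]; ring
    refine ⟨fun x => if f x = f a then f b else f x, ?_, ?_⟩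
    · have hsub : (S.image fun x => if f x = f a then f b else f x) ⊆ (S.image f).erase (f a) := by
        intro y hy
        obtain ⟨x, hx, rfl⟩ := mem_image.1 hy
        rw [mem_erase]
        split_ifs with h
        · exact ⟨hab.symm, mem_image_of_mem _ hb⟩
        · exact ⟨h, mem_image_of_mem _ hx⟩
      have h3 := card_le_card hsub
      have h4 := card_erase_add_one (mem_image_of_mem f ha)
      omega
    · intro x hx y hy hxy
      dsimp only at hxy
      split_ifs at hxy with h3 h4 h4
      · have := hf2 x hx y hy (h3.trans h4.symm); omega
      · have e1 := hf2 x hx a ha h3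
        have e2 := hf2 b hb y hy hxy
        have e3 := ht x a y
        have e4 := ht a b y
        omega
      · have e1 := hf2 x hx b hb hxy
        have e2 := hf2 a ha y hy h4.symm
        have e3 := ht x b y
        have e4 := ht b a y
        have e5 := hc a b
        omega
      · have := hf2 x hx y hy hxy; omega

end count

end BH

namespace BH

section pauli

variable {L D K : ℕ} [NeZero L] {A : Type} [Fintype A]

theorem symp_add {Q : Type} [Fintype Q] (G E F : Pauli Q) :
    sympForm G (E + F) = sympForm G E + sympForm G F := by
  unfold sympForm
  rw [← Finset.sum_add_distrib]
  refine Finset.sum_congr rfl fun q _ => ?_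
  simp only [Pi.add_apply, Prod.fst_add, Prod.snd_add]; ring

theorem symp_zero {Q : Type} [Fintype Q] (G : Pauli Q) : sympForm G 0 = 0 := by
  simp [sympForm]

theorem symp_sub {Q : Type} [Fintype Q] (G E F : Pauli Q) :
    sympForm G (E - F) = sympForm G E - sympForm G F := by
  have := symp_add G (E - F) F
  rw [sub_add_cancel] at this
  rw [this]; ring

theorem symp_ne {Q : Type} [Fintype Q] {G E : Pauli Q} (h : sympForm G E ≠ 0) :
    ∃ q, G q ≠ 0 ∧ E q ≠ 0 := by
  by_contra! hc
  refine h (Finset.sum_eq_zero fun q _ => ?_)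
  by_cases hg : G q = 0
  · simp [hg]
  · simp [hc q hg]

theorem zmod2_cases : ∀ x y : ZMod 2, (x - y = 1 ↔ ¬ (x = 1 ↔ y = 1)) := by decide

theorem zmod2_ne : ∀ x : ZMod 2, x ≠ 0 ↔ x = 1 := by decide

variable (code : Code L D K A)

theorem mem_syn {E : Pauli (Site L D × Fin K)} {a : A} :
    a ∈ code.syndrome E ↔ sympForm (code.G a) E = 1 := by
  simp [Code.syndrome]

theorem mem_syn_sub {E F : Pauli (Site L D × Fin K)} {a : A} :
    a ∈ code.syndrome (E - F) ↔ ¬ (a ∈ code.syndrome E ↔ a ∈ code.syndrome F) := by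
  simp only [mem_syn, symp_sub, zmod2_cases]

theorem syn_zero : code.syndrome 0 = ∅ := by
  ext a; simp [mem_syn, symp_zero]

theorem stab_symp {g : Pauli (Site L D × Fin K)} (hg : g ∈ code.stab) (a : A) :
    sympForm (code.G a) g = 0 := by
  unfold Code.stab at hg
  induction hg using AddSubgroup.closure_induction with
  | mem x hx => obtain ⟨b, rfl⟩ := hx; exact code.comm a b
  | zero => exact symp_zero _
  | add x y _ _ hx hy => rw [symp_add, hx, hy, add_zero]
  | neg x _ hx => rw [← zero_sub, symp_sub, symp_zero, hx, sub_zero]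

theorem syn_eq_of_stab {E F : Pauli (Site L D × Fin K)} (h : E - F ∈ code.stab) :
    code.syndrome E = code.syndrome F := by
  ext a
  have := stab_symp code h a
  rw [symp_sub, sub_eq_zero] at this
  rw [mem_syn, mem_syn, this]

/-- `v` is within distance `w` of the defects in `S` -/
def Near (w : ℕ) (S : Finset A) (v : Site L D) : Prop :=
  ∃ a ∈ S, dist' (code.loc a) v ≤ w

theorem Near.mono {code : Code L D K A} {w w' : ℕ} {S S' : Finset A} {v : Site L D}
    (h : Near code w S v) (hw : w ≤ w') (hS : ∀ a ∈ S, a ∈ S') : Near code w' S' v := by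
  obtain ⟨a, ha, h⟩ := h
  exact ⟨a, hS a ha, h.trans hw⟩

/-- every defect in `S` is within distance `m` of `U` -/
def SNear (m : ℕ) (S U : Finset A) : Prop := ∀ a ∈ S, Near code m U (code.loc a)

theorem Near.trans {code : Code L D K A} {w m n : ℕ} {S U : Finset A} {v : Site L D}
    (h : Near code w S v) (hS : SNear code m S U) (hn : w + m ≤ n) : Near code n U v := by
  obtain ⟨a, ha, h⟩ := h
  obtain ⟨b, hb, h'⟩ := hS a ha
  exact ⟨b, hb, (dist'_triangle _ (code.loc a) _).trans (by omega)⟩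

theorem supp_add {E F : Pauli (Site L D × Fin K)} {q} (h : (E + F) q ≠ 0) : E q ≠ 0 ∨ F q ≠ 0 := by
  by_contra! hc
  exact h (by simp [hc.1, hc.2])

theorem supp_sub {E F : Pauli (Site L D × Fin K)} {q} (h : (E - F) q ≠ 0) : E q ≠ 0 ∨ F q ≠ 0 := by
  by_contra! hc
  exact h (by simp [hc.1, hc.2])

theorem supp_near_syn {E : Pauli (Site L D × Fin K)} {a : A} (h : a ∈ code.syndrome E) :
    ∃ q, E q ≠ 0 ∧ dist' (code.loc a) q.1 ≤ 1 := by
  rw [mem_syn, ← zmod2_ne] at h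
  obtain ⟨q, h1, h2⟩ := symp_ne h
  exact ⟨q, h2, elemCube_dist (code.localGen a q h1)⟩

/-- restriction of `E` to the ball of radius `R` around `x` -/
def restr (E : Pauli (Site L D × Fin K)) (x : Site L D) (R : ℕ) : Pauli (Site L D × Fin K) :=
  fun q => if dist' x q.1 ≤ R then E q else 0

theorem restr_supp {E : Pauli (Site L D × Fin K)} {x : Site L D} {R : ℕ} {q}
    (h : restr E x R q ≠ 0) : dist' x q.1 ≤ R ∧ E q ≠ 0 := by
  unfold restr at h
  split_ifs at h with h1
  · exact ⟨h1, h⟩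
  · exact absurd rfl h

theorem restr_small {E : Pauli (Site L D × Fin K)} {x : Site L D} {R : ℕ} {l : ℝ}
    (h : 2 * (R : ℝ) ≤ l) : smallSupp (restr E x R) l :=
  ⟨corner x R, fun _ hq => mem_cube (restr_supp hq).1 h⟩

theorem restr_syn (E : Pauli (Site L D × Fin K)) (x : Site L D) (R : ℕ)
    (hgap : ∀ q, E q ≠ 0 → dist' x q.1 ≤ R + 2 → dist' x q.1 ≤ R) :
    ∀ b, b ∈ code.syndrome (restr E x R) ↔
      b ∈ code.syndrome E ∧ dist' x (code.loc b) ≤ R + 1 := by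
  intro b
  by_cases hb : dist' x (code.loc b) ≤ R + 1
  · simp only [hb, and_true, mem_syn]
    have : sympForm (code.G b) (restr E x R) = sympForm (code.G b) E := by
      unfold sympForm
      refine Finset.sum_congr rfl fun q _ => ?_
      unfold restr
      split_ifs with h
      · rfl
      · by_cases hE : E q = 0
        · simp [hE]
        · by_cases hG : code.G b q = 0
          · simp [hG]
          · have h1 := elemCube_dist (code.localGen b q hG)
            have h2 := dist'_triangle x (code.loc b) q.1
            exact absurd (hgap q hE (by omega)) h
    rw [this]
  · simp only [hb, and_false, iff_false]
    intro h
    rw [mem_syn, ← zmod2_ne] at h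
    obtain ⟨q, h1, h2⟩ := symp_ne h
    have h3 := elemCube_dist (code.localGen b q h1)
    have h4 := (restr_supp h2).1
    have h5 := dist'_triangle x q.1 (code.loc b)
    rw [dist'_comm] at h3
    omega

/-- Distances between defects of `S` avoid the interval `(r, B]`. -/
def Gap (r B : ℕ) (S : Finset A) : Prop :=
  ∀ a ∈ S, ∀ b ∈ S, dist' (code.loc a) (code.loc b) ≤ B → dist' (code.loc a) (code.loc b) ≤ r

/-- the cluster of `a` in `S` -/
def cl (r : ℕ) (S : Finset A) (a : A) : Finset A :=
  S.filter fun b => dist' (code.loc a) (code.loc b) ≤ r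

/-- all clusters are charged -/
def Charged (Ltqo : ℝ) (r : ℕ) (S : Finset A) : Prop :=
  ∀ a ∈ S, ¬ code.neutral Ltqo (cl code r S a)

variable {code} {Ltqo : ℝ}

/-- local annihilation of a neutral cluster -/
theorem neutral_local (h2 : code.tqo2 Ltqo) {S : Finset A} (hS : code.neutral Ltqo S) {a : A}
    (ha : a ∈ S) {r : ℕ} (hr : ∀ b ∈ S, dist' (code.loc a) (code.loc b) ≤ r) :
    ∃ E, code.syndrome E = S ∧ ∀ q, E q ≠ 0 → dist' (code.loc a) q.1 ≤ 2 * r + 2 := by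
  obtain ⟨c, n, hmin, hn⟩ := exists_minEnclosing (code.synSites S : Set (Site L D))
  obtain ⟨E, hE, hsupp⟩ := h2 S hS c n hmin
  refine ⟨E, hE, fun q hq => ?_⟩
  have hle : n ≤ 2 * r + 1 := by
    refine hn (corner (code.loc a) r) _ fun v hv => ?_
    simp only [Code.synSites, coe_biUnion, Set.mem_iUnion, mem_coe] at hv
    obtain ⟨b, hb, hv⟩ := hv
    exact elem_mem_cube (hr b hb) hv
  obtain ⟨u, hu, huq⟩ := hsupp q hq
  have hau : code.loc a ∈ cubeSet c (n : ℝ) := by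
    refine hmin.2.1 ?_
    simp only [Code.synSites, coe_biUnion, Set.mem_iUnion, mem_coe]
    exact ⟨a, ha, self_mem_elemCube _⟩
  have e1 := cube_dist le_rfl hau hu
  have e2 : dist' u q.1 ≤ 1 := by exact_mod_cast huq
  have e3 := dist'_triangle (code.loc a) u q.1
  omega

/-- Lemma N: removing neutral clusters. -/
theorem clean (h2 : code.tqo2 Ltqo) {r : ℕ} (F : Pauli (Site L D × Fin K)) :
    ∃ F', (∀ q, (F' - F) q ≠ 0 → Near code (2 * r + 2) (code.syndrome F) q.1) ∧
      (∀ a ∈ code.syndrome F', a ∈ code.syndrome F) ∧ Charged code Ltqo r (code.syndrome F') := by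
  classical
  let P : ℕ → Prop := fun n => ∃ F',
    (∀ q, (F' - F) q ≠ 0 → Near code (2 * r + 2) (code.syndrome F) q.1) ∧
      (∀ a ∈ code.syndrome F', a ∈ code.syndrome F) ∧ (code.syndrome F').card = n
  have hex : ∃ n, P n := ⟨_, F, by simp, fun _ h => h, rfl⟩
  obtain ⟨F', hs, hsub, hcard⟩ := Nat.find_spec hex
  refine ⟨F', hs, hsub, fun a ha hneu => ?_⟩
  have haC : a ∈ cl code r (code.syndrome F') a := by simp [cl, ha, dist'_self]
  obtain ⟨E, hE, hEs⟩ := neutral_local h2 hneu haC (r := r) (by simp [cl])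
  have key : ∀ b, b ∈ code.syndrome (F' - E) ↔
      b ∈ code.syndrome F' ∧ ¬ b ∈ cl code r (code.syndrome F') a := by
    intro b
    rw [mem_syn_sub, hE]
    have : b ∈ cl code r (code.syndrome F') a → b ∈ code.syndrome F' := by
      simp only [cl, mem_filter]; exact fun h => h.1
    tauto
  refine Nat.find_min hex (m := (code.syndrome (F' - E)).card) ?_ ⟨F' - E, ?_, ?_, rfl⟩
  · rw [← hcard]
    refine card_lt_card ⟨fun b hb => ((key b).1 hb).1, fun h => ?_⟩
    exact ((key a).1 (h ha)).2 haC
  · intro q hq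
    have : F' - E - F = (F' - F) - E := by abel
    rw [this] at hq
    rcases supp_sub hq with h | h
    · exact hs q h
    · exact ⟨a, hsub a ha, hEs q h⟩
  · exact fun b hb => hsub b ((key b).1 hb).1

/-- Lemma A: removing trivial isolated pieces. -/
theorem prune (h1 : code.tqo1 Ltqo) (E : Pauli (Site L D × Fin K)) (V : Site L D → Prop) {R : ℕ}
    (hR : 2 * (R : ℝ) ≤ Ltqo)
    (hV : ∀ q, E q ≠ 0 → ¬ V q.1 → ∃ R' ≤ R,
      (∀ q', E q' ≠ 0 → dist' q.1 q'.1 ≤ R' + 2 → dist' q.1 q'.1 ≤ R') ∧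
      ∀ b ∈ code.syndrome E, ¬ dist' q.1 (code.loc b) ≤ R' + 1) :
    ∃ E', E - E' ∈ code.stab ∧ ∀ q, E' q ≠ 0 → V q.1 := by
  classical
  let P : ℕ → Prop := fun n => ∃ E', E - E' ∈ code.stab ∧ (∀ q, E' q ≠ 0 → E q ≠ 0) ∧
    (Finset.univ.filter fun q => E' q ≠ 0).card = n
  have hex : ∃ n, P n := ⟨_, E, by simp, fun _ h => h, rfl⟩
  obtain ⟨E', hs, hsub, hcard⟩ := Nat.find_spec hex
  refine ⟨E', hs, fun q hq => ?_⟩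
  by_contra hVq
  obtain ⟨R', hR', hg, hd⟩ := hV q (hsub q hq) hVq
  have hsyn := restr_syn code E' q.1 R' fun q' hq' => hg q' (hsub q' hq')
  have hstab : restr E' q.1 R' ∈ code.stab := by
    refine h1 _ (restr_small ?_) ?_
    · refine le_trans ?_ hR
      have : (R' : ℝ) ≤ R := by exact_mod_cast hR'
      linarith
    · refine Finset.eq_empty_of_forall_notMem fun b hb => ?_
      rw [hsyn, ← syn_eq_of_stab code hs] at hb
      exact hd b hb.1 hb.2
  have hval : ∀ q', (E' - restr E' q.1 R') q' ≠ 0 → E' q' ≠ 0 ∧ ¬ dist' q.1 q'.1 ≤ R' := by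
    intro q' h
    simp only [Pi.sub_apply, restr] at h
    split_ifs at h with h'
    · simp at h
    · exact ⟨by simpa using h, h'⟩
  refine Nat.find_min hex (m := (Finset.univ.filter fun q' => (E' - restr E' q.1 R') q' ≠ 0).card)
    ?_ ⟨E' - restr E' q.1 R', ?_, fun q' h => hsub q' (hval q' h).1, rfl⟩
  · rw [← hcard]
    refine card_lt_card ⟨fun b hb => ?_, fun h => ?_⟩
    · simp only [mem_filter, mem_univ, true_and] at hb ⊢
      exact (hval b hb).1
    · have := h (show q ∈ _ by simpa using hq)
      simp only [mem_filter, mem_univ, true_and] at this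
      exact (hval q this).2 (by simp [dist'_self])
  · have : E - (E' - restr E' q.1 R') = (E - E') + restr E' q.1 R' := by abel
    rw [this]
    exact code.stab.add_mem hs hstab

end pauli

end BH

namespace BH

section step

variable {L D K : ℕ} [NeZero L] {A : Type} [Fintype A] {code : Code L D K A} {Ltqo : ℝ}

theorem two_mul_le {B R : ℕ} (hB : (B : ℝ) ≤ Ltqo) (h : 2 * R ≤ B) : 2 * (R : ℝ) ≤ Ltqo :=
  le_trans (by exact_mod_cast h) hB

theorem prune2_aux {r B : ℕ} (hr : 1 ≤ r) (hB : 200 * r ≤ B)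
    (E : Pauli (Site L D × Fin K)) {S S' : Finset A}
    (hS : Gap code r B S) (hS' : Gap code r B S')
    (hE : ∀ q, E q ≠ 0 → Near code (5 * r) S q.1 ∨ Near code (5 * r) S' q.1)
    (q : Site L D × Fin K) (hq : Near code (5 * r) S q.1) :
    ∃ R' ≤ 24 * r, ∀ q', E q' ≠ 0 → dist' q.1 q'.1 ≤ R' + 2 → dist' q.1 q'.1 ≤ R' := by
  obtain ⟨s, hs, hsq⟩ := hq
  have nearS : ∀ q' : Site L D × Fin K, Near code (5 * r) S q'.1 → dist' q.1 q'.1 ≤ 26 * r →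
      dist' q.1 q'.1 ≤ 11 * r := by
    rintro q' ⟨s', hs', hsq'⟩ hd
    have e1 := dist'_triangle (code.loc s) q.1 (code.loc s')
    have e2 := dist'_triangle q.1 q'.1 (code.loc s')
    have e3 := dist'_comm (code.loc s') q'.1
    have e4 := hS s hs s' hs' (by omega)
    have e5 := dist'_triangle q.1 (code.loc s) q'.1
    have e6 := dist'_triangle (code.loc s) (code.loc s') q'.1
    have e7 := dist'_comm (code.loc s) q.1
    omega
  by_cases hcase : ∀ q', E q' ≠ 0 → dist' q.1 q'.1 ≤ 11 * r + 2 → dist' q.1 q'.1 ≤ 11 * r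
  · exact ⟨11 * r, by omega, hcase⟩
  push Not at hcase
  obtain ⟨y, hy, hy1, hy2⟩ := hcase
  have hyS' : Near code (5 * r) S' y.1 := by
    rcases hE y hy with h | h
    · have := nearS y h (by omega); omega
    · exact h
  obtain ⟨s', hs', hsy⟩ := hyS'
  refine ⟨24 * r, le_rfl, fun q' hq' hd => ?_⟩
  rcases hE q' hq' with h | ⟨s'', hs'', h⟩
  · have := nearS q' h (by omega); omega
  · have e1 := dist'_triangle (code.loc s') y.1 (code.loc s'')
    have e2 := dist'_triangle y.1 q.1 (code.loc s'')
    have e3 := dist'_comm y.1 q.1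
    have e4 := dist'_triangle q.1 q'.1 (code.loc s'')
    have e5 := dist'_comm (code.loc s'') q'.1
    have e6 := hS' s' hs' s'' hs'' (by omega)
    have e7 := dist'_triangle q.1 y.1 q'.1
    have e8 := dist'_triangle y.1 (code.loc s') q'.1
    have e9 := dist'_triangle (code.loc s') (code.loc s'') q'.1
    have e10 := dist'_comm (code.loc s') y.1
    omega

theorem prune2 (h1 : code.tqo1 Ltqo) {r B : ℕ} (hr : 1 ≤ r) (hB : 200 * r ≤ B)
    (hBL : (B : ℝ) ≤ Ltqo) (E : Pauli (Site L D × Fin K)) {S S' : Finset A}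
    (hS : Gap code r B S) (hS' : Gap code r B S')
    (hE : ∀ q, E q ≠ 0 → Near code (5 * r) S q.1 ∨ Near code (5 * r) S' q.1) :
    ∃ E', E - E' ∈ code.stab ∧ ∀ q, E' q ≠ 0 → Near code (26 * r) (code.syndrome E) q.1 := by
  refine prune h1 E _ (R := 24 * r) (two_mul_le hBL (by omega)) fun q hq hV => ?_
  have : ∃ R' ≤ 24 * r, ∀ q', E q' ≠ 0 → dist' q.1 q'.1 ≤ R' + 2 → dist' q.1 q'.1 ≤ R' := by
    rcases hE q hq with h | h
    · exact prune2_aux hr hB E hS hS' hE q h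
    · exact prune2_aux hr hB E hS' hS (fun q hq => (hE q hq).symm) q h
  obtain ⟨R', hR', hg⟩ := this
  refine ⟨R', hR', hg, fun b hb hd => hV ⟨b, hb, ?_⟩⟩
  rw [dist'_comm]; omega

theorem prune1 (h1 : code.tqo1 Ltqo) {r B : ℕ} (hr : 1 ≤ r) (hB : 200 * r ≤ B)
    (hBL : (B : ℝ) ≤ Ltqo) (E : Pauli (Site L D × Fin K)) {U S : Finset A}
    (hS : Gap code r B S)
    (hE : ∀ q, E q ≠ 0 → Near code (5 * r) U q.1 ∨ Near code (5 * r) S q.1) :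
    ∃ E', E - E' ∈ code.stab ∧ ∀ q, E' q ≠ 0 →
      Near code (26 * r) U q.1 ∨ Near code (26 * r) (code.syndrome E) q.1 := by
  refine prune h1 E (fun v => Near code (26 * r) U v ∨ Near code (26 * r) (code.syndrome E) v)
    (R := 11 * r) (two_mul_le hBL (by omega)) fun q hq hV => ?_
  push Not at hV
  refine ⟨11 * r, le_rfl, fun q' hq' hd => ?_, fun b hb hd => hV.2 ⟨b, hb, ?_⟩⟩
  · rcases hE q hq with h | ⟨s, hs, hsq⟩
    · exact absurd (h.mono (by omega) fun _ h => h) hV.1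
    rcases hE q' hq' with ⟨u, hu, h⟩ | ⟨s', hs', hsq'⟩
    · refine absurd ⟨u, hu, ?_⟩ hV.1
      have e1 := dist'_triangle (code.loc u) q'.1 q.1
      have e2 := dist'_comm q.1 q'.1
      omega
    · have e1 := dist'_triangle (code.loc s) q.1 (code.loc s')
      have e2 := dist'_triangle q.1 q'.1 (code.loc s')
      have e3 := dist'_comm (code.loc s') q'.1
      have e4 := hS s hs s' hs' (by omega)
      have e5 := dist'_triangle q.1 (code.loc s) q'.1
      have e6 := dist'_triangle (code.loc s) (code.loc s') q'.1
      have e7 := dist'_comm (code.loc s) q.1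
      omega
  · rw [dist'_comm]; omega

/-- charged clusters created by `Z` are near `U` -/
theorem charged_near {r B : ℕ} (hr : 1 ≤ r) (hB : 200 * r ≤ B)
    (hBL : (B : ℝ) ≤ Ltqo) (Z : Pauli (Site L D × Fin K)) {U S : Finset A}
    (hS : Gap code r B S) (hch : Charged code Ltqo r S)
    (hZ : ∀ q, Z q ≠ 0 → Near code (26 * r) U q.1 ∨ Near code (26 * r) S q.1)
    (hsyn : ∀ b, b ∈ code.syndrome Z ↔ ¬ (b ∈ U ↔ b ∈ S)) : SNear code (55 * r) S U := by
  intro a ha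
  by_contra hfar
  have hgap : ∀ q, Z q ≠ 0 → dist' (code.loc a) q.1 ≤ 27 * r + 2 →
      dist' (code.loc a) q.1 ≤ 27 * r := by
    intro q hq hd
    rcases hZ q hq with ⟨u, hu, h⟩ | ⟨s, hs, h⟩
    · refine absurd ⟨u, hu, ?_⟩ hfar
      have e1 := dist'_triangle (code.loc u) q.1 (code.loc a)
      have e2 := dist'_comm q.1 (code.loc a)
      omega
    · have e1 := dist'_triangle (code.loc a) q.1 (code.loc s)
      have e2 := dist'_comm q.1 (code.loc s)
      have e3 := hS a ha s hs (by omega)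
      have e4 := dist'_triangle (code.loc a) (code.loc s) q.1
      omega
  have hU : ∀ b ∈ U, ¬ dist' (code.loc a) (code.loc b) ≤ 27 * r + 1 := fun b hb hd =>
    hfar ⟨b, hb, by rw [dist'_comm]; omega⟩
  refine hch a ha ⟨restr Z (code.loc a) (27 * r), ?_, restr_small (two_mul_le hBL (by omega))⟩
  ext b
  rw [restr_syn code Z _ _ hgap, hsyn]
  simp only [cl, mem_filter]
  constructor
  · rintro ⟨h, hd⟩
    have hb : b ∈ S := by
      by_contra hb
      exact h ⟨fun h => absurd hd (hU b h), fun h => absurd h hb⟩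
    exact ⟨hb, hS a ha b hb (by omega)⟩
  · rintro ⟨hb, hd⟩
    exact ⟨fun h => hU b (h.2 hb) (by omega), by omega⟩

/-- charged clusters cannot move far -/
theorem charged_confined {α : ℝ} (hα : 1 ≤ α) (hns : code.noStrings Ltqo α) {r ρ B : ℕ}
    (hr : 1 ≤ r) (hρ : (α + 2) * (2 * r + 1) ≤ ρ) (hB : 2 * ρ + 200 * r ≤ B)
    (hBL : (B : ℝ) ≤ Ltqo) (Y : Pauli (Site L D × Fin K)) {S S' : Finset A}
    (hS : Gap code r B S) (hS' : Gap code r B S') (hch : Charged code Ltqo r S')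
    (hY : ∀ q, Y q ≠ 0 → Near code (ρ + 81 * r) S q.1)
    (hsyn : ∀ b, b ∈ code.syndrome Y ↔ ¬ (b ∈ S ↔ b ∈ S')) : SNear code ρ S' S := by
  intro a ha
  by_contra hfar
  have hfar' : ∀ b ∈ S, ρ < dist' (code.loc b) (code.loc a) := fun b hb => by
    by_contra h
    exact hfar ⟨b, hb, by omega⟩
  have hrρ : 6 * r ≤ ρ := by
    have : (6 * r : ℝ) ≤ ρ := by
      have : (0 : ℝ) ≤ r := Nat.cast_nonneg _
      nlinarith
    exact_mod_cast this
  have haS : a ∉ S := fun h => by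
    have := hfar' a h
    rw [dist'_self] at this; omega
  have haY : a ∈ code.syndrome Y := (hsyn a).2 fun h => haS (h.2 ha)
  obtain ⟨q0, hq0, hq0a⟩ := supp_near_syn code haY
  obtain ⟨s, hs, hsq⟩ := hY q0 hq0
  have hsa : dist' (code.loc s) (code.loc a) ≤ ρ + 81 * r + 1 := by
    have e1 := dist'_triangle (code.loc s) q0.1 (code.loc a)
    have e2 := dist'_comm (code.loc a) q0.1
    omega
  have hgap : ∀ q, Y q ≠ 0 → dist' (code.loc s) q.1 ≤ (ρ + 82 * r) + 2 →
      dist' (code.loc s) q.1 ≤ ρ + 82 * r := by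
    intro q hq hd
    obtain ⟨s', hs', h⟩ := hY q hq
    have e1 := dist'_triangle (code.loc s) q.1 (code.loc s')
    have e2 := dist'_comm q.1 (code.loc s')
    have e3 := hS s hs s' hs' (by omega)
    have e4 := dist'_triangle (code.loc s) (code.loc s') q.1
    omega
  set W := restr Y (code.loc s) (ρ + 82 * r) with hW
  have hWsyn := restr_syn code Y _ _ hgap
  rw [← hW] at hWsyn
  -- description of the syndrome of `W`
  have hmem : ∀ b, b ∈ code.syndrome W →
      (b ∈ S' ∧ dist' (code.loc a) (code.loc b) ≤ r) ∨ dist' (code.loc s) (code.loc b) ≤ r := by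
    intro b hb
    obtain ⟨hb, hd⟩ := (hWsyn b).1 hb
    by_cases hbS : b ∈ S
    · exact Or.inr (hS s hs b hbS (by omega))
    · have hb' : b ∈ S' := by
        by_contra h
        exact (hsyn b).1 hb ⟨fun h => absurd h hbS, fun h' => absurd h' h⟩
      refine Or.inl ⟨hb', hS' a ha b hb' ?_⟩
      have e1 := dist'_triangle (code.loc a) (code.loc s) (code.loc b)
      have e2 := dist'_comm (code.loc a) (code.loc s)
      omega
  have hmem' : ∀ b, b ∈ S' → dist' (code.loc a) (code.loc b) ≤ r → b ∈ code.syndrome W := by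
    intro b hb hd
    rw [hWsyn, hsyn]
    refine ⟨fun h => ?_, ?_⟩
    · have := hfar' b (h.2 hb)
      rw [dist'_comm] at this
      omega
    · have e1 := dist'_triangle (code.loc s) (code.loc a) (code.loc b)
      omega
  have hρ' : (((2 * r + 1 : ℕ)) : ℝ) = 2 * r + 1 := by push_cast; ring
  have hdist : ∀ u ∈ cubeSet (corner (code.loc s) r) ((2 * r + 1 : ℕ) : ℝ),
      ∀ v ∈ cubeSet (corner (code.loc a) r) ((2 * r + 1 : ℕ) : ℝ),
      α * ((2 * r + 1 : ℕ) : ℝ) < ((dist' u v : ℕ) : ℝ) := by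
    intro u hu v hv
    have e1 : dist' (code.loc s) u ≤ 2 * r + 1 := cube_dist le_rfl
      (elem_mem_cube (by rw [dist'_self]; omega) (self_mem_elemCube _)) hu
    have e2 : dist' (code.loc a) v ≤ 2 * r + 1 := cube_dist le_rfl
      (elem_mem_cube (by rw [dist'_self]; omega) (self_mem_elemCube _)) hv
    have e3 := dist'_triangle (code.loc s) u (code.loc a)
    have e4 := dist'_triangle u v (code.loc a)
    have e5 := dist'_comm v (code.loc a)
    have e6 := hfar' s hs
    have e7 : ρ < dist' u v + 2 * (2 * r + 1) := by omega
    have e8 : (ρ : ℝ) < dist' u v + 2 * (2 * r + 1) := by exact_mod_cast e7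
    rw [hρ']; linarith
  have hαpos : 0 < α * ((2 * r + 1 : ℕ) : ℝ) := by positivity
  have hdisj : Disjoint (cubeSet (corner (code.loc s) r) ((2 * r + 1 : ℕ) : ℝ))
      (cubeSet (corner (code.loc a) r) ((2 * r + 1 : ℕ) : ℝ)) := by
    rw [Set.disjoint_left]
    intro u hu hv
    have := hdist u hu u hv
    rw [dist'_self] at this
    push_cast at this hαpos
    linarith
  have := (hns W ((2 * r + 1 : ℕ) : ℝ) (corner (code.loc s) r) (corner (code.loc a) r)
    (by positivity) (restr_small (two_mul_le hBL (by omega))) hdisj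
    (fun u hu v hv => (hdist u hu v hv).le) ?_).2
  · refine hch a ha ?_
    convert this using 1
    ext b
    simp only [cl, Code.partIn, mem_filter]
    constructor
    · rintro ⟨hb, hd⟩
      exact ⟨hmem' b hb hd, fun v hv => elem_mem_cube hd hv⟩
    · rintro ⟨hb, hd⟩
      rcases hmem b hb with h | h
      · exact h
      · exact absurd (hd _ (self_mem_elemCube _))
          (Set.disjoint_left.1 hdisj (elem_mem_cube h (self_mem_elemCube _)))
  · intro v hv
    simp only [Code.synSites, coe_biUnion, Set.mem_iUnion, mem_coe] at hv
    obtain ⟨b, hb, hv⟩ := hv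
    rcases hmem b hb with h | h
    · exact Or.inr (elem_mem_cube h.2 hv)
    · exact Or.inl (elem_mem_cube h hv)

variable (code) in
/-- `F` and `F'` are connected by an operator localized near their syndromes. -/
def Conn (w : ℕ) (F F' : Pauli (Site L D × Fin K)) : Prop :=
  ∃ Y, F' - F - Y ∈ code.stab ∧
    ∀ q, Y q ≠ 0 → Near code w (code.syndrome F) q.1 ∨ Near code w (code.syndrome F') q.1

theorem Conn.mono {w w' : ℕ} {F F' : Pauli (Site L D × Fin K)} (h : Conn code w F F')
    (hw : w ≤ w') : Conn code w' F F' := by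
  obtain ⟨Y, h1, h2⟩ := h
  exact ⟨Y, h1, fun q hq => (h2 q hq).imp (fun h => h.mono hw fun _ h => h)
    (fun h => h.mono hw fun _ h => h)⟩

theorem Conn.symm {w : ℕ} {F F' : Pauli (Site L D × Fin K)} (h : Conn code w F F') :
    Conn code w F' F := by
  obtain ⟨Y, h1, h2⟩ := h
  refine ⟨-Y, ?_, fun q hq => (h2 q (by simpa using hq)).symm⟩
  have : F - F' - -Y = -(F' - F - Y) := by abel
  rw [this]
  exact code.stab.neg_mem h1

variable (code Ltqo) in
/-- `G'` is obtained from `G` by removing neutral clusters -/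
def Cleaned (r : ℕ) (G G' : Pauli (Site L D × Fin K)) : Prop :=
  (∀ q, (G' - G) q ≠ 0 → Near code (4 * r) (code.syndrome G) q.1) ∧
    (∀ a ∈ code.syndrome G', a ∈ code.syndrome G) ∧ Charged code Ltqo r (code.syndrome G')

theorem exists_cleaned (h2 : code.tqo2 Ltqo) {r : ℕ} (hr : 1 ≤ r)
    (G : Pauli (Site L D × Fin K)) : ∃ G', Cleaned code Ltqo r G G' := by
  obtain ⟨G', h, h', h''⟩ := clean (r := r) h2 G
  exact ⟨G', fun q hq => (h q hq).mono (by omega) fun _ h => h, h', h''⟩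

theorem Gap.sub {r B : ℕ} {S S' : Finset A} (h : Gap code r B S) (hs : ∀ a ∈ S', a ∈ S) :
    Gap code r B S' := fun a ha b hb => h a (hs a ha) b (hs b hb)

theorem link_mid (h1 : code.tqo1 Ltqo) {r B : ℕ} (hr : 1 ≤ r) (hB : 200 * r ≤ B)
    (hBL : (B : ℝ) ≤ Ltqo) {F F' G G' : Pauli (Site L D × Fin K)}
    (hc : Conn code r F G) (hF : Gap code r B (code.syndrome F))
    (hG : Gap code r B (code.syndrome G))
    (hF' : Cleaned code Ltqo r F F') (hG' : Cleaned code Ltqo r G G') :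
    ∃ Z, G' - F' - Z ∈ code.stab ∧
      (∀ q, Z q ≠ 0 → Near code (26 * r) (code.syndrome F') q.1 ∨
        Near code (26 * r) (code.syndrome G') q.1) ∧
      SNear code (55 * r) (code.syndrome G') (code.syndrome F') := by
  obtain ⟨Y, hY, hYs⟩ := hc
  set E := Y + ((G' - G) - (F' - F)) with hE
  have hst : G' - F' - E ∈ code.stab := by
    have : G' - F' - E = G - F - Y := by rw [hE]; abel
    rwa [this]
  obtain ⟨Z, hZ, hZs⟩ := prune2 h1 hr hB hBL E hF hG (by
    intro q hq
    rcases supp_add hq with h | h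
    · exact (hYs q h).imp (fun h => h.mono (by omega) fun _ h => h)
        (fun h => h.mono (by omega) fun _ h => h)
    · rcases supp_sub h with h | h
      · exact Or.inr ((hG'.1 q h).mono (by omega) fun _ h => h)
      · exact Or.inl ((hF'.1 q h).mono (by omega) fun _ h => h))
  have hst' : G' - F' - Z ∈ code.stab := by
    have : G' - F' - Z = (G' - F' - E) + (E - Z) := by abel
    rw [this]; exact code.stab.add_mem hst hZ
  have hZs' : ∀ q, Z q ≠ 0 → Near code (26 * r) (code.syndrome F') q.1 ∨
        Near code (26 * r) (code.syndrome G') q.1 := by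
    intro q hq
    obtain ⟨a, ha, hd⟩ := hZs q hq
    rw [← syn_eq_of_stab code hst, mem_syn_sub] at ha
    by_cases haF : a ∈ code.syndrome F'
    · exact Or.inl ⟨a, haF, hd⟩
    · by_cases haG : a ∈ code.syndrome G'
      · exact Or.inr ⟨a, haG, hd⟩
      · tauto
  refine ⟨Z, hst', hZs', charged_near hr hB hBL Z (hG.sub hG'.2.1) hG'.2.2 hZs' fun b => ?_⟩
  rw [← syn_eq_of_stab code hst', mem_syn_sub]
  tauto

theorem link_end (h1 : code.tqo1 Ltqo) {r B : ℕ} (hr : 1 ≤ r) (hB : 200 * r ≤ B)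
    (hBL : (B : ℝ) ≤ Ltqo) {F G G' : Pauli (Site L D × Fin K)}
    (hc : Conn code r F G) (hG : Gap code r B (code.syndrome G))
    (hG' : Cleaned code Ltqo r G G') :
    ∃ Z, G' - F - Z ∈ code.stab ∧
      (∀ q, Z q ≠ 0 → Near code (81 * r) (code.syndrome F) q.1) ∧
      SNear code (55 * r) (code.syndrome G') (code.syndrome F) := by
  obtain ⟨Y, hY, hYs⟩ := hc
  set E := Y + (G' - G) with hE
  have hst : G' - F - E ∈ code.stab := by
    have : G' - F - E = G - F - Y := by rw [hE]; abel
    rwa [this]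
  obtain ⟨Z, hZ, hZs⟩ := prune1 h1 hr hB hBL E (U := code.syndrome F) hG (by
    intro q hq
    rcases supp_add hq with h | h
    · exact (hYs q h).imp (fun h => h.mono (by omega) fun _ h => h)
        (fun h => h.mono (by omega) fun _ h => h)
    · exact Or.inr ((hG'.1 q h).mono (by omega) fun _ h => h))
  have hst' : G' - F - Z ∈ code.stab := by
    have : G' - F - Z = (G' - F - E) + (E - Z) := by abel
    rw [this]; exact code.stab.add_mem hst hZ
  have hZs' : ∀ q, Z q ≠ 0 → Near code (26 * r) (code.syndrome F) q.1 ∨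
        Near code (26 * r) (code.syndrome G') q.1 := by
    intro q hq
    rcases hZs q hq with h | ⟨a, ha, hd⟩
    · exact Or.inl h
    rw [← syn_eq_of_stab code hst, mem_syn_sub] at ha
    by_cases haF : a ∈ code.syndrome F
    · exact Or.inl ⟨a, haF, hd⟩
    · by_cases haG : a ∈ code.syndrome G'
      · exact Or.inr ⟨a, haG, hd⟩
      · tauto
  have hn : SNear code (55 * r) (code.syndrome G') (code.syndrome F) := by
    refine charged_near hr hB hBL Z (hG.sub hG'.2.1) hG'.2.2 hZs' fun b => ?_
    rw [← syn_eq_of_stab code hst', mem_syn_sub]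
    tauto
  refine ⟨Z, hst', fun q hq => ?_, hn⟩
  rcases hZs' q hq with h | h
  · exact h.mono (by omega) fun _ h => h
  · exact h.trans hn (by omega)

theorem step {α : ℝ} (hα : 1 ≤ α) (h1 : code.tqo1 Ltqo) (h2 : code.tqo2 Ltqo)
    (hns : code.noStrings Ltqo α) {r ρ B : ℕ}
    (hr : 1 ≤ r) (hρ : (α + 2) * (2 * r + 1) ≤ ρ) (hB : 2 * ρ + 200 * r ≤ B)
    (hBL : (B : ℝ) ≤ Ltqo) {F0 F1 Fl Fn : Pauli (Site L D × Fin K)}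
    (h01 : Conn code r F0 F1) (hg1 : Gap code r B (code.syndrome F1))
    (hch : Relation.ReflTransGen
      (fun F G => Conn code r F G ∧ Gap code r B (code.syndrome G)) F1 Fl)
    (hln : Conn code r Fl Fn) : Conn code B F0 Fn := by
  obtain ⟨F1', hF1'⟩ := exists_cleaned h2 hr F1
  have inv : Gap code r B (code.syndrome Fl) ∧ ∃ G' Y, Cleaned code Ltqo r Fl G' ∧
      G' - F1' - Y ∈ code.stab ∧
      (∀ q, Y q ≠ 0 → Near code (ρ + 26 * r) (code.syndrome F1') q.1) ∧
      SNear code ρ (code.syndrome G') (code.syndrome F1') := by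
    clear hln
    induction hch with
    | refl =>
      refine ⟨hg1, F1', 0, hF1', by simp, by simp, fun a ha => ⟨a, ha, ?_⟩⟩
      rw [dist'_self]; omega
    | @tail G H _ hGH ih =>
      obtain ⟨hgG, G', Y, hG', hY, hYs, hn⟩ := ih
      obtain ⟨hc, hgH⟩ := hGH
      obtain ⟨H', hH'⟩ := exists_cleaned h2 hr H
      obtain ⟨Z, hZ, hZs, hZn⟩ := link_mid h1 hr (by omega) hBL hc hgG hgH hG' hH'
      have hst : H' - F1' - (Y + Z) ∈ code.stab := by
        have : H' - F1' - (Y + Z) = (G' - F1' - Y) + (H' - G' - Z) := by abel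
        rw [this]; exact code.stab.add_mem hY hZ
      have hn' : SNear code ρ (code.syndrome H') (code.syndrome F1') := by
        refine charged_confined hα hns hr hρ hB hBL (Y + Z) (hg1.sub hF1'.2.1)
          (hgH.sub hH'.2.1) hH'.2.2 ?_ fun b => ?_
        · intro q hq
          rcases supp_add hq with h | h
          · exact (hYs q h).mono (by omega) fun _ h => h
          · rcases hZs q h with h | h
            · exact h.trans hn (by omega)
            · have h' : Near code (81 * r) (code.syndrome G') q.1 := h.trans hZn (by omega)
              exact h'.trans hn (by omega)
        · rw [← syn_eq_of_stab code hst, mem_syn_sub]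
          tauto
      refine ⟨hgH, H', Y + Z, hH', hst, fun q hq => ?_, hn'⟩
      rcases supp_add hq with h | h
      · exact hYs q h
      · rcases hZs q h with h | h
        · exact h.trans hn (by omega)
        · exact h.trans hn' (by omega)
  obtain ⟨hgl, G', Y, hG', hY, hYs, -⟩ := inv
  obtain ⟨Z0, hZ0, hZ0s, hn0⟩ := link_end h1 hr (by omega) hBL h01 hg1 hF1'
  obtain ⟨Zn, hZn, hZns, -⟩ := link_end h1 hr (by omega) hBL hln.symm hgl hG'
  refine ⟨(Y + Z0) - Zn, ?_, fun q hq => ?_⟩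
  · have : Fn - F0 - ((Y + Z0) - Zn) = (F1' - F0 - Z0) + (G' - F1' - Y) - (G' - Fn - Zn) := by abel
    rw [this]
    exact code.stab.sub_mem (code.stab.add_mem hZ0 hY) hZn
  · rcases supp_sub hq with h | h
    · rcases supp_add h with h | h
      · exact Or.inl ((hYs q h).trans hn0 (by omega))
      · exact Or.inl ((hZ0s q h).mono (by omega) fun _ h => h)
    · exact Or.inr ((hZns q h).mono (by omega) fun _ h => h)

end step

end BH

namespace BH

section main

variable {L D K : ℕ} [NeZero L] {A : Type} [Fintype A] {code : Code L D K A} {Ltqo : ℝ}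

theorem single_stab (h1 : code.tqo1 Ltqo) (hL : 0 ≤ Ltqo) {E : Pauli (Site L D × Fin K)}
    (hE : singleQubit E) (hs : code.syndrome E = ∅) : E ∈ code.stab := by
  obtain ⟨q, hq⟩ := hE
  refine h1 E ⟨corner q.1 0, fun q' hq' => ?_⟩ hs
  rw [hq q' hq']
  exact mem_cube (by rw [dist'_self]) (by simpa using hL)

theorem conn_single (h1 : code.tqo1 Ltqo) (hL : 0 ≤ Ltqo) {F F' : Pauli (Site L D × Fin K)}
    (hE : singleQubit (F' - F)) : Conn code 1 F F' := by
  by_cases hs : code.syndrome (F' - F) = ∅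
  · exact ⟨0, by simpa using single_stab h1 hL hE hs, by simp⟩
  · obtain ⟨a, ha⟩ := Finset.nonempty_iff_ne_empty.2 hs
    refine ⟨F' - F, by simp, fun q hq => ?_⟩
    obtain ⟨q', hq', hd⟩ := supp_near_syn code ha
    obtain ⟨q0, hq0⟩ := hE
    rw [hq0 q' hq', ← hq0 q hq] at hd
    rw [mem_syn_sub] at ha
    by_cases haF : a ∈ code.syndrome F
    · exact Or.inl ⟨a, haF, hd⟩
    · by_cases haG : a ∈ code.syndrome F'
      · exact Or.inr ⟨a, haG, hd⟩
      · tauto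

theorem levels {α : ℝ} (hα : 1 ≤ α) (h1 : code.tqo1 Ltqo) (h2 : code.tqo2 Ltqo)
    (hns : code.noStrings Ltqo α) (hL : 0 ≤ Ltqo) {n M : ℕ} (hn : α ≤ n) (hM : M = 6 * n + 212)
    (F : ℕ → Pauli (Site L D × Fin K)) (T : ℕ)
    (hF : ∀ t < T, singleQubit (F (t + 1) - F t)) (p : ℕ) :
    (((M + 2) ^ p : ℕ) : ℝ) ≤ Ltqo → ∀ t t', t < t' → t' ≤ T →
      (∀ s, t < s → s < t' → ∃ q < p, Gap code ((M + 2) ^ q) (M * (M + 2) ^ q)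
        (code.syndrome (F s))) → Conn code ((M + 2) ^ p) (F t) (F t') := by
  induction p with
  | zero =>
    intro _ t t' htt' ht' hs
    have : t' = t + 1 := by
      by_contra hne
      obtain ⟨q, hq, -⟩ := hs (t + 1) (by omega) (by omega)
      omega
    subst this
    rw [pow_zero]
    exact conn_single h1 hL (hF t (by omega))
  | succ p ih =>
    intro hLp t t' htt' ht' hs
    set r := (M + 2) ^ p with hr
    have hr1 : 1 ≤ r := Nat.one_le_pow _ _ (by omega)
    have hpow : (M + 2) ^ (p + 1) = M * r + 2 * r := by rw [pow_succ]; ring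
    have hBL : ((M * r : ℕ) : ℝ) ≤ Ltqo := le_trans (by
      rw [hpow]; exact_mod_cast Nat.le_add_right _ _) hLp
    have hrM : r ≤ M * r := Nat.le_mul_of_pos_left _ (by omega)
    have hLr : ((r : ℕ) : ℝ) ≤ Ltqo := le_trans (by exact_mod_cast hrM) hBL
    have ih := ih hLr
    have hρ : (α + 2) * (2 * r + 1) ≤ (((3 * n + 6) * r : ℕ) : ℝ) := by
      have e1 : (1 : ℝ) ≤ r := by exact_mod_cast hr1
      push_cast
      have e2 : (α + 2) * (2 * r + 1) ≤ (n + 2) * (3 * r) := by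
        apply mul_le_mul <;> linarith
      linarith
    have hB : 2 * ((3 * n + 6) * r) + 200 * r ≤ M * r := by
      rw [hM]; apply le_of_eq; ring
    let R := fun F G => Conn code r F G ∧ Gap code r (M * r) (code.syndrome G)
    -- scanning the history
    have scan : ∀ s, t < s → s ≤ t' → ∃ u, t ≤ u ∧ u < s ∧
        (∀ x, u < x → x < s → ∃ q < p, Gap code ((M + 2) ^ q) (M * (M + 2) ^ q)
          (code.syndrome (F x))) ∧
        (u = t ∨ ∃ F1, Conn code r (F t) F1 ∧ Gap code r (M * r) (code.syndrome F1) ∧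
          Relation.ReflTransGen R F1 (F u)) := by
      intro s hts
      induction s, hts using Nat.le_induction with
      | base => exact fun _ => ⟨t, le_rfl, by omega, fun x _ _ => by omega, Or.inl rfl⟩
      | succ s hts ihs =>
        intro hst'
        obtain ⟨u, htu, hus, hx, hu⟩ := ihs (by omega)
        by_cases hsp : ∃ q < p, Gap code ((M + 2) ^ q) (M * (M + 2) ^ q) (code.syndrome (F s))
        · refine ⟨u, htu, by omega, fun x hux hxs => ?_, hu⟩
          by_cases hxe : x = s
          · subst hxe; exact hsp
          · exact hx x hux (by omega)
        · have hgs : Gap code r (M * r) (code.syndrome (F s)) := by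
            obtain ⟨q, hq, hg⟩ := hs s (by omega) (by omega)
            rcases Nat.lt_succ_iff_lt_or_eq.1 hq with h | h
            · exact absurd ⟨q, h, hg⟩ hsp
            · rw [hr, ← h]; exact hg
          have hc := ih u s hus (by omega) hx
          refine ⟨s, by omega, by omega, fun x _ _ => by omega, Or.inr ?_⟩
          rcases hu with rfl | ⟨F1, hF1, hg1, hch⟩
          · exact ⟨F s, hc, hgs, Relation.ReflTransGen.refl⟩
          · exact ⟨F1, hF1, hg1, hch.tail ⟨hc, hgs⟩⟩
    obtain ⟨u, htu, hut', hx, hu⟩ := scan t' htt' le_rfl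
    have hc := ih u t' hut' ht' hx
    rcases hu with rfl | ⟨F1, hF1, hg1, hch⟩
    · exact hc.mono (by omega)
    · exact (step hα h1 h2 hns hr1 hρ hB hBL hF1 hg1 hch hc).mono (by omega)

theorem partialSum_zero {Q : Type} {T : ℕ} (Ep : Fin T → Pauli Q) : partialSum Ep 0 = 0 := by
  simp [partialSum]

theorem partialSum_succ {Q : Type} {T : ℕ} (Ep : Fin T → Pauli Q) (t : ℕ) (ht : t < T) :
    partialSum Ep (t + 1) - partialSum Ep t = Ep ⟨t, ht⟩ := by
  unfold partialSum
  rw [← Finset.sum_sub_distrib, Finset.sum_eq_single ⟨t, ht⟩]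
  · simp
  · intro s _ hs
    have : (s : ℕ) ≠ t := fun h => hs (Fin.ext h)
    by_cases h : (s : ℕ) < t
    · simp [h, Nat.lt_succ_of_lt h]
    · have h' : ¬ (s : ℕ) < t + 1 := by omega
      simp [h, h']
  · simp

theorem barrier {α : ℝ} (hα : 1 ≤ α) (h1 : code.tqo1 Ltqo) (h2 : code.tqo2 Ltqo)
    (hns : code.noStrings Ltqo α) (hL : 0 ≤ Ltqo) {n M : ℕ} (hn : α ≤ n) (hM : M = 6 * n + 212)
    (p : ℕ) (hp : (((M + 2) ^ p : ℕ) : ℝ) ≤ Ltqo) (P : Pauli (Site L D × Fin K))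
    (hP : code.logical P) (T : ℕ) (Ep : Fin T → Pauli (Site L D × Fin K))
    (hEp : ∀ t, singleQubit (Ep t)) (hT : partialSum Ep T = P) :
    ∃ t ≤ T, p + 1 ≤ (code.syndrome (partialSum Ep t)).card := by
  classical
  by_contra! hcon
  refine hP.2 ?_
  have hstep : ∀ t < T, singleQubit (partialSum Ep (t + 1) - partialSum Ep t) := fun t ht => by
    rw [partialSum_succ Ep t ht]; exact hEp _
  rcases Nat.eq_zero_or_pos p with rfl | hp0
  · have : ∀ t ≤ T, partialSum Ep t ∈ code.stab := by
      intro t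
      induction t with
      | zero => intro _; rw [partialSum_zero]; exact code.stab.zero_mem
      | succ t ih =>
        intro ht
        have e := single_stab h1 hL (hstep t ht) (by
          have hz : ∀ s ≤ T, code.syndrome (partialSum Ep s) = ∅ := fun s hs =>
            Finset.card_eq_zero.1 (by have := hcon s hs; omega)
          ext a
          rw [mem_syn_sub, hz t (by omega), hz (t + 1) ht]
          simp)
        have := code.stab.add_mem e (ih (by omega))
        rwa [sub_add_cancel] at this
    rw [← hT]; exact this T le_rfl
  · rcases Nat.eq_zero_or_pos T with rfl | hT0
    · rw [← hT, partialSum_zero]; exact code.stab.zero_mem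
    have hc := levels hα h1 h2 hns hL hn hM (partialSum Ep) T hstep p hp 0 T hT0 le_rfl (by
      intro s _ hs
      by_contra! hd
      obtain ⟨f, hf, -⟩ := count_levels (fun a b => dist' (code.loc a) (code.loc b))
        (fun a => dist'_self _) (fun a b => dist'_comm _ _) (fun a b c => dist'_triangle _ _ _)
        (code.syndrome (partialSum Ep s)) (fun q => (M + 2) ^ q) M
        (fun q => by rw [pow_succ]; ring) p (by
          intro q hq
          have := hd q hq
          unfold Gap at this
          push Not at this
          obtain ⟨a, ha, b, hb, h3, h4⟩ := this
          exact ⟨a, ha, b, hb, h4, h3⟩)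
      have h3 := hcon s hs.le
      have h4 : 0 < ((code.syndrome (partialSum Ep s)).image f).card := by
        rw [Finset.card_pos, Finset.image_nonempty, ← Finset.card_pos]; omega
      omega)
    obtain ⟨Y, hY, hYs⟩ := hc
    rw [hT, partialSum_zero] at hY hYs
    have hPe : code.syndrome P = ∅ := by
      ext a; simp [mem_syn, hP.1 a]
    have hY0 : Y = 0 := by
      funext q
      by_contra hq
      rw [hPe, syn_zero] at hYs
      rcases hYs q hq with ⟨a, ha, -⟩ | ⟨a, ha, -⟩ <;> simp at ha
    simpa [hY0] using hY

end main

end BH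

namespace BH

/-- There is a constant `c > 0`, depending only on the spatial
dimension `D`, the no-strings constant `α ≥ 1` and the exponent `β > 0`, such
that for every `L ≥ 2`: any local stabilizer code on `(ℤ/Lℤ)^D` satisfying the
topological order conditions at some scale `Ltqo ≥ L^β` and the no-strings rule
with constant `α` has every logical operator with energy barrier at least
`c·log L`. -/
theorem energy_barrier_log (D : ℕ) (α β : ℝ) (hα : 1 ≤ α) (hβ : 0 < β) :
    ∃ c : ℝ, 0 < c ∧
      ∀ (L : ℕ) [NeZero L] (K : ℕ), 2 ≤ L →
        ∀ (A : Type) [Fintype A] (code : Code L D K A) (Ltqo : ℝ),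
          (L : ℝ) ^ β ≤ Ltqo →
          code.tqo Ltqo →
          code.noStrings Ltqo α →
          ∀ P, code.logical P → code.barrierAtLeast P (c * Real.log L) := by
  obtain ⟨n, hn⟩ := exists_nat_ge α
  set M := 6 * n + 212 with hM
  have hMpos : (1 : ℝ) < ((M + 2 : ℕ) : ℝ) := by
    have : 1 < M + 2 := by omega
    exact_mod_cast this
  have hlog : 0 < Real.log ((M + 2 : ℕ) : ℝ) := Real.log_pos hMpos
  refine ⟨β / Real.log ((M + 2 : ℕ) : ℝ), by positivity, ?_⟩
  intro L _ K hL A _ code Ltqo hLt htqo hns P hP T Ep hEp hT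
  have hL0 : (0 : ℝ) < L := by
    have : 0 < L := by omega
    exact_mod_cast this
  have hLlog : 0 ≤ Real.log L := Real.log_natCast_nonneg L
  have hx0 : 0 ≤ β / Real.log ((M + 2 : ℕ) : ℝ) * Real.log L := by positivity
  set x := β / Real.log ((M + 2 : ℕ) : ℝ) * Real.log L with hx
  have hpw : (((M + 2) ^ ⌊x⌋₊ : ℕ) : ℝ) ≤ Ltqo := by
    refine le_trans ?_ hLt
    have hpos : (0 : ℝ) < ((M + 2) ^ ⌊x⌋₊ : ℕ) := by positivity
    rw [← Real.log_le_log_iff hpos (by positivity), Real.log_rpow hL0, Nat.cast_pow,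
      Real.log_pow]
    have h1 : (⌊x⌋₊ : ℝ) ≤ x := Nat.floor_le hx0
    calc (⌊x⌋₊ : ℝ) * Real.log ((M + 2 : ℕ) : ℝ) ≤ x * Real.log ((M + 2 : ℕ) : ℝ) := by gcongr
      _ = β * Real.log L := by rw [hx]; field_simp
  have hLnn : 0 ≤ Ltqo := le_trans (by positivity) hpw
  obtain ⟨t, ht, hcard⟩ := barrier hα htqo.1 htqo.2 hns hLnn hn hM _ hpw P hP T Ep hEp hT
  refine ⟨t, ht, ?_⟩
  have h1 : x < ⌊x⌋₊ + 1 := Nat.lt_floor_add_one x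
  have h2 : ((⌊x⌋₊ + 1 : ℕ) : ℝ) ≤ ((code.syndrome (partialSum Ep t)).card : ℝ) := by
    exact_mod_cast hcard
  push_cast at h2
  linarith

end BH
end

section
/- Let α ≥ 1 and let S be a nonempty finite set of elementary cubes in (ℤ/Lℤ)^D (each elementary cube has l_∞ diameter 1). If S is dense at every level q = 0, 1, …, p, then S contains at least p + 2 cubes. -/
open Finset

namespace BH

/-- The `l_∞` diameter of a finite set of elementary cubes, each cube given by
its corner. -/
def cubesDiam {L D : ℕ} [NeZero L] (S : Finset (Site L D)) : ℕ :=
  fdiam (S.biUnion elemCube)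

/-- `P` is a partition of the set `S` of elementary cubes into disjoint clusters,
each of diameter at most `ξ(p)`, such that the union of any two distinct
clusters has diameter greater than `ξ(p+1)`. -/
def clusterPartition {L D : ℕ} [NeZero L] (α : ℝ) (p : ℕ)
    (S : Finset (Site L D)) (P : Finset (Finset (Site L D))) : Prop :=
  (∀ C ∈ P, C.Nonempty) ∧
  (∀ C ∈ P, C ⊆ S) ∧
  (∀ x ∈ S, ∃! C, C ∈ P ∧ x ∈ C) ∧
  (∀ C ∈ P, (cubesDiam C : ℝ) ≤ ξ α p) ∧
  (∀ C ∈ P, ∀ C' ∈ P, C ≠ C' → ξ α (p + 1) < (cubesDiam (C ∪ C') : ℝ))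

/-- A nonempty finite set of elementary cubes is sparse at level `p` iff it
admits a level-`p` cluster partition; otherwise it is dense at level `p`. -/
def sparseAt {L D : ℕ} [NeZero L] (α : ℝ) (p : ℕ) (S : Finset (Site L D)) : Prop :=
  ∃ P, clusterPartition α p S P

/-- A nonempty set of elementary cubes that is not sparse at level `p` is dense
at level `p`. -/
def denseAt {L D : ℕ} [NeZero L] (α : ℝ) (p : ℕ) (S : Finset (Site L D)) : Prop :=
  S.Nonempty ∧ ¬ sparseAt α p S

end BH

namespace BH


lemma zmod_val_one_le {L : ℕ} [NeZero L] : (1 : ZMod L).val ≤ 1 := by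
  rw [ZMod.val_one_eq_one_mod]
  exact Nat.mod_le _ _

lemma cDist_le_one {L : ℕ} [NeZero L] (a b c : ZMod L) (ha : (a - c).val ≤ 1)
    (hb : (b - c).val ≤ 1) : cDist a b ≤ 1 := by
  have key : ∀ x : ZMod L, x.val ≤ 1 → x = 0 ∨ x = 1 := by
    intro x hx
    have h := ZMod.natCast_zmod_val x
    interval_cases hv : x.val
    · left; simpa using h.symm
    · right; simpa using h.symm
  have e1 : a - b = (a - c) - (b - c) := by ring
  have e2 : b - a = (b - c) - (a - c) := by ring
  unfold cDist
  rw [e1, e2]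
  have := zmod_val_one_le (L := L)
  rcases key _ ha with h | h <;> rcases key _ hb with h' | h' <;> rw [h, h'] <;> simp [this]

lemma cubesDiam_singleton {L D : ℕ} [NeZero L] (c : Site L D) : cubesDiam {c} ≤ 1 := by
  unfold cubesDiam fdiam dist'
  rw [Finset.singleton_biUnion]
  refine Finset.sup_le fun u hu => Finset.sup_le fun v hv => Finset.sup_le fun i _ => ?_
  simp only [elemCube, Finset.mem_filter, Finset.mem_univ, true_and] at hu hv
  exact cDist_le_one _ _ (c i) (hu i) (hv i)

lemma exists_clusters {L D : ℕ} [NeZero L] (α : ℝ) (hα : 1 ≤ α) (S : Finset (Site L D))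
    (q : ℕ) (hdense : ∀ r < q, denseAt α r S) :
    ∃ P : Finset (Finset (Site L D)), (∀ C ∈ P, C.Nonempty) ∧ (∀ C ∈ P, C ⊆ S) ∧
      (∀ x ∈ S, ∃! C, C ∈ P ∧ x ∈ C) ∧ (∀ C ∈ P, (cubesDiam C : ℝ) ≤ ξ α q) ∧
      P.card + q ≤ S.card := by
  classical
  induction q with
  | zero =>
    refine ⟨S.image fun x => {x}, ?_, ?_, ?_, ?_, ?_⟩
    · simp
    · simp
    · intro x hx
      refine ⟨{x}, by simp [hx], ?_⟩
      rintro C ⟨hC, hxC⟩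
      obtain ⟨y, _, rfl⟩ := Finset.mem_image.1 hC
      rw [Finset.mem_singleton.1 hxC]
    · intro C hC
      obtain ⟨y, _, rfl⟩ := Finset.mem_image.1 hC
      simpa [ξ] using cubesDiam_singleton y
    · exact Finset.card_image_le
  | succ q ih =>
    obtain ⟨P, h1, h2, h3, h4, h5⟩ := ih fun r hr => hdense r (by omega)
    have hd := (hdense q (by omega)).2
    have : ∃ A ∈ P, ∃ B ∈ P, A ≠ B ∧ (cubesDiam (A ∪ B) : ℝ) ≤ ξ α (q + 1) := by
      by_contra! hcon
      exact hd ⟨P, h1, h2, h3, h4, hcon⟩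
    obtain ⟨A, hA, B, hB, hAB, hdiam⟩ := this
    refine ⟨insert (A ∪ B) ((P.erase A).erase B), ?_, ?_, ?_, ?_, ?_⟩
    · intro C hC
      rcases Finset.mem_insert.1 hC with rfl | hC
      · exact (h1 A hA).mono Finset.subset_union_left
      · exact h1 C (Finset.mem_of_mem_erase (Finset.mem_of_mem_erase hC))
    · intro C hC
      rcases Finset.mem_insert.1 hC with rfl | hC
      · exact Finset.union_subset (h2 A hA) (h2 B hB)
      · exact h2 C (Finset.mem_of_mem_erase (Finset.mem_of_mem_erase hC))
    · intro x hx
      obtain ⟨C, ⟨hC, hxC⟩, hu⟩ := h3 x hx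
      by_cases hx' : x ∈ A ∪ B
      · refine ⟨A ∪ B, ⟨Finset.mem_insert_self _ _, hx'⟩, ?_⟩
        rintro E ⟨hE, hxE⟩
        rcases Finset.mem_insert.1 hE with rfl | hE
        · rfl
        · exfalso
          simp only [Finset.mem_erase] at hE
          obtain ⟨hEB, hEA, hE⟩ := hE
          have := hu E ⟨hE, hxE⟩
          rcases Finset.mem_union.1 hx' with h | h
          · exact hEA (this.trans (hu A ⟨hA, h⟩).symm)
          · exact hEB (this.trans (hu B ⟨hB, h⟩).symm)
      · have hCA : C ≠ A := by
          rintro rfl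
          exact hx' (Finset.mem_union_left _ hxC)
        have hCB : C ≠ B := by
          rintro rfl
          exact hx' (Finset.mem_union_right _ hxC)
        refine ⟨C, ⟨by simp [hC, hCA, hCB], hxC⟩, ?_⟩
        rintro E ⟨hE, hxE⟩
        rcases Finset.mem_insert.1 hE with rfl | hE
        · exact absurd hxE hx'
        · exact hu E ⟨Finset.mem_of_mem_erase (Finset.mem_of_mem_erase hE), hxE⟩
    · intro C hC
      rcases Finset.mem_insert.1 hC with rfl | hC
      · exact hdiam
      · refine (h4 C (Finset.mem_of_mem_erase (Finset.mem_of_mem_erase hC))).trans ?_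
        unfold ξ
        exact pow_le_pow_right₀ (by linarith) (Nat.le_succ q)
    · have c1 := Finset.card_insert_le (A ∪ B) ((P.erase A).erase B)
      have c2 := Finset.card_erase_add_one (Finset.mem_erase.2 ⟨hAB.symm, hB⟩)
      have c3 := Finset.card_erase_add_one hA
      omega

/-- Lemma 1 of Bravyi–Haah. Let `α ≥ 1` and let `S` be a
nonempty finite set of elementary cubes in `(ℤ/Lℤ)^D`. If `S` is dense at every
level `q = 0, 1, …, p`, then `S` contains at least `p + 2` cubes. -/
theorem dense_card_lower_bound (L D : ℕ) [NeZero L] (α : ℝ) (hα : 1 ≤ α)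
    (S : Finset (Site L D)) (hS : S.Nonempty) (p : ℕ)
    (hdense : ∀ q ≤ p, denseAt α q S) :
    p + 2 ≤ S.card := by
  obtain ⟨P, _, _, h3, _, h5⟩ :=
    exists_clusters α hα S (p + 1) fun r hr => hdense r (by omega)
  obtain ⟨x, hx⟩ := hS
  obtain ⟨C, ⟨hC, _⟩, _⟩ := h3 x hx
  have := Finset.card_pos.2 ⟨C, hC⟩
  omega

end BH
end
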